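/- Let M be a queue machine that does not terminate from the initial configuration (q1, $). Then at most one distributive law extends the induced stream biGSOS law ρ_M: if λ and λ' are distributive laws both extending ρ_M, then λ = λ'. -/

import Mathlib

/-- Σ-terms over a signature: `Op` is the set of operation symbols, `ar` the arity. -/
inductive Term (Op : Type) (ar : Op → ℕ) (X : Type) : Type
  | var : X → Term Op ar X
  | op : (o : Op) → (Fin (ar o) → Term Op ar X) → Term Op ar X

namespace Term
variable {Op : Type} {ar : Op → ℕ}

/-- Functorial action of `Σ*` (term substitution of variables). -/
def map {X Y : Type} (f : X → Y) : Term Op ar X → Term Op ar Y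
  | var x => var (f x)
  | op o ts => op o fun i => (ts i).map f

/-- Multiplication `μ` of the free monad: flattening of terms of terms. -/
def join {X : Type} : Term Op ar (Term Op ar X) → Term Op ar X
  | var t => t
  | op o ts => op o fun i => (ts i).join

end Term

/-- Comultiplication `δ` of the cofree comonad on `B X = A × X`:
color each position of a stream with the tail starting there. -/
def sTails {A X : Type} (σ : Stream' (X × A)) : Stream' (Stream' (X × A) × A) :=
  fun n => (σ.drop n, (σ n).2)

/-- The first transition of a stream: its first label together with its second state. -/
def firstTrans {A Z : Type} (s : Stream' (Z × A)) : A × Z := ((s 0).2, (s 1).1)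

/-- A distributive law of the free monad `Σ*` over the cofree comonad `B^∞`
for the stream behaviour `B X = A × X`: a natural family
`λ_X : Σ*(B^∞ X) → B^∞(Σ* X)` satisfying the four axioms (i)-(iv). -/
structure DistLaw (Op : Type) (ar : Op → ℕ) (A : Type) : Type 1 where
  law : ∀ X : Type, Term Op ar (Stream' (X × A)) → Stream' (Term Op ar X × A)
  natural : ∀ (X Y : Type) (f : X → Y) (u : Term Op ar (Stream' (X × A))),
      law Y (u.map (Stream'.map (Prod.map f id))) =
        Stream'.map (Prod.map (Term.map f) id) (law X u)
  /-- (i): on a bare stream, `λ` returns the same stream, states regarded as terms. -/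
  ax_unit : ∀ (X : Type) (σ : Stream' (X × A)),
      law X (Term.var σ) = Stream'.map (Prod.map Term.var id) σ
  /-- (ii): the first state of `λ_X u` is `u` with each stream replaced by its first state. -/
  ax_counit : ∀ (X : Type) (u : Term Op ar (Stream' (X × A))),
      (law X u 0).1 = u.map fun σ => (σ 0).1
  /-- (iii): compositionality with respect to terms. -/
  ax_mult : ∀ (X : Type) (u : Term Op ar (Term Op ar (Stream' (X × A)))),
      law X u.join =
        Stream'.map (Prod.map Term.join id) (law (Term Op ar X) (u.map (law X)))
  /-- (iv): decompositionality with respect to streams (`δΣ* ∘ λ = B^∞λ ∘ λB^∞ ∘ Σ*δ`):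
  applying `λ_X` to the n-th state of `λ_X u`, with each variable occurrence replaced by
  the residual input stream starting at it, yields the n-th tail of `λ_X u`. -/
  ax_comult : ∀ (X : Type) (u : Term Op ar (Stream' (X × A))),
      Stream'.map (Prod.map (law X) id) (law (Stream' (X × A)) (u.map sTails)) =
        sTails (law X u)

/-- A queue machine `M = (Q, A, $, q1, δ0, δ1, δ2)`: a finite set `Q` of states, a finite
alphabet `A` with a chosen symbol `$ ∈ A`, a starting state `q1 ∈ Q`, and three partial
transition functions `δ0, δ1, δ2` that are disjointly defined and jointly total. -/
structure QM : Type 1 where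
  Q : Type
  A : Type
  fintypeQ : Fintype Q
  fintypeA : Fintype A
  dollar : A
  q1 : Q
  d0 : Q → Option (Q × A)
  d1 : Q → A → Option (Q × A)
  d2 : Q → A → A → Option (Q × A)
  /-- for each `q, a, b`, exactly one of `δ0(q)`, `δ1(q,a)`, `δ2(q,a,b)` is defined -/
  exactOne : ∀ q a b,
      ((d0 q).isSome ∧ d1 q a = none ∧ d2 q a b = none) ∨
      (d0 q = none ∧ (d1 q a).isSome ∧ d2 q a b = none) ∨
      (d0 q = none ∧ d1 q a = none ∧ (d2 q a b).isSome)

/-- The step relation on configurations `(q, w) ∈ Q × A*`: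
`(q, w) → (q', w·c)` if `δ0(q) = (q', c)`;
`(q, a·w) → (q', w·c)` if `δ0(q)` is undefined and `δ1(q, a) = (q', c)`;
`(q, a·b·w) → (q', w·c)` if `δ0(q), δ1(q, a)` are undefined and `δ2(q, a, b) = (q', c)`. -/
inductive QM.Step (M : QM) : M.Q × List M.A → M.Q × List M.A → Prop
  | step0 {q w q' c} : M.d0 q = some (q', c) → QM.Step M (q, w) (q', w ++ [c])
  | step1 {q a w q' c} : M.d0 q = none → M.d1 q a = some (q', c) →
      QM.Step M (q, a :: w) (q', w ++ [c])
  | step2 {q a b w q' c} : M.d0 q = none → M.d1 q a = none → M.d2 q a b = some (q', c) →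
      QM.Step M (q, a :: b :: w) (q', w ++ [c])

/-- A configuration with no successor. -/
def QM.Stuck (M : QM) (cfg : M.Q × List M.A) : Prop := ∀ c', ¬ M.Step cfg c'

/-- `M` terminates from the initial configuration `(q1, $)`: some finite sequence of
steps reaches a configuration with no successor. -/
def QM.Terminates (M : QM) : Prop :=
  ∃ cfg, Relation.ReflTransGen M.Step (M.q1, [M.dollar]) cfg ∧ M.Stuck cfg

/-- The signature induced by a queue machine: one constant `C` (symbol `none`) and a
unary operation symbol for every state `q ∈ Q` (symbols `some q`). -/
def QM.Op (M : QM) : Type := Option M.Q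

/-- Arities for the signature of a queue machine. -/
def QM.ar (M : QM) : M.Op → ℕ := fun o => o.elim 0 fun _ => 1

/-- The constant term `C`. -/
def QM.CT (M : QM) (X : Type) : Term M.Op M.ar X := Term.op none Fin.elim0

/-- Application of the unary operation symbol `q`. -/
def QM.qT (M : QM) {X : Type} (q : M.Q) (t : Term M.Op M.ar X) : Term M.Op M.ar X :=
  Term.op (some q) fun _ => t

/-- A distributive law `λ` extends the biGSOS law `ρ_M` induced by the queue machine
`M` (given by the rules `C →$ q1(C)`; `q(x0 →a0 ⋯) →c q'(x0)` if `δ0(q) = (q', c)`;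
`q(x0 →a0 x1 →a1 ⋯) →c q'(x1)` if `δ0(q)` is undefined and `δ1(q, a0) = (q', c)`;
`q(x0 →a0 x1 →a1 x2 →a2 ⋯) →c q'(x2)` if `δ0(q), δ1(q, a0)` are undefined and
`δ2(q, a0, a1) = (q', c)`) if for every set `X` and every `t ∈ Σ(B^∞ X)` the first
transition of `λ_X(ι(t))` (its first label together with its second state) equals
`ρ_M` applied to `t`. -/
def QM.ExtendsRho (M : QM) (lam : DistLaw M.Op M.ar M.A) : Prop :=
  (∀ X : Type,
    firstTrans (lam.law X (M.CT (Stream' (X × M.A)))) = (M.dollar, M.qT M.q1 (M.CT X))) ∧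
  (∀ (X : Type) (q : M.Q) (σ : Stream' (X × M.A)) (q' : M.Q) (c : M.A),
    M.d0 q = some (q', c) →
    firstTrans (lam.law X (M.qT q (Term.var σ))) = (c, M.qT q' (Term.var (σ 0).1))) ∧
  (∀ (X : Type) (q : M.Q) (σ : Stream' (X × M.A)) (q' : M.Q) (c : M.A),
    M.d0 q = none → M.d1 q (σ 0).2 = some (q', c) →
    firstTrans (lam.law X (M.qT q (Term.var σ))) = (c, M.qT q' (Term.var (σ 1).1))) ∧
  (∀ (X : Type) (q : M.Q) (σ : Stream' (X × M.A)) (q' : M.Q) (c : M.A),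
    M.d0 q = none → M.d1 q (σ 0).2 = none → M.d2 q (σ 0).2 (σ 1).2 = some (q', c) →
    firstTrans (lam.law X (M.qT q (Term.var σ))) = (c, M.qT q' (Term.var (σ 2).1)))

/-- Transition of the machine in state `q` seeing labels `a, b`, consuming `j` symbols. -/
def QM.Tr (M : QM) (q : M.Q) (a b : M.A) (q' : M.Q) (c : M.A) (j : ℕ) : Prop :=
  (M.d0 q = some (q', c) ∧ j = 0) ∨
  (M.d0 q = none ∧ M.d1 q a = some (q', c) ∧ j = 1) ∨
  (M.d0 q = none ∧ M.d1 q a = none ∧ M.d2 q a b = some (q', c) ∧ j = 2)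

theorem QM.exists_Tr (M : QM) (q : M.Q) (a b : M.A) : ∃ q' c j, M.Tr q a b q' c j := by
  rcases M.exactOne q a b with ⟨h, -, -⟩ | ⟨h0, h, -⟩ | ⟨h0, h1, h⟩ <;>
    obtain ⟨⟨q', c⟩, hh⟩ := Option.isSome_iff_exists.1 h
  · exact ⟨q', c, 0, Or.inl ⟨hh, rfl⟩⟩
  · exact ⟨q', c, 1, Or.inr (Or.inl ⟨h0, hh, rfl⟩)⟩
  · exact ⟨q', c, 2, Or.inr (Or.inr ⟨h0, h1, hh, rfl⟩)⟩

theorem DistLaw.drop_law {Op : Type} {ar : Op → ℕ} {A : Type} (lam : DistLaw Op ar A)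
    (X : Type) (u : Term Op ar (Stream' (X × A))) (n : ℕ) :
    (lam.law X u).drop n = lam.law X (lam.law _ (u.map sTails) n).1 := by
  have := congrArg Prod.fst (congrFun (lam.ax_comult X u) n)
  exact this.symm

theorem QM.firstTrans_of_Tr (M : QM) (lam : DistLaw M.Op M.ar M.A) (h : M.ExtendsRho lam)
    (X : Type) (q : M.Q) (σ : Stream' (X × M.A)) (q' : M.Q) (c : M.A) (j : ℕ)
    (ht : M.Tr q (σ 0).2 (σ 1).2 q' c j) :
    firstTrans (lam.law X (M.qT q (Term.var σ))) = (c, M.qT q' (Term.var (σ j).1)) := by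
  obtain ⟨-, h0, h1, h2⟩ := h
  rcases ht with ⟨a, rfl⟩ | ⟨a, b, rfl⟩ | ⟨a, b, d, rfl⟩
  · exact h0 X q σ q' c a
  · exact h1 X q σ q' c a b
  · exact h2 X q σ q' c a b d

theorem QM.law_zero (M : QM) (lam : DistLaw M.Op M.ar M.A) (h : M.ExtendsRho lam)
    (X : Type) (q : M.Q) (σ : Stream' (X × M.A)) (q' : M.Q) (c : M.A) (j : ℕ)
    (ht : M.Tr q (σ 0).2 (σ 1).2 q' c j) :
    lam.law X (M.qT q (Term.var σ)) 0 = (M.qT q (Term.var (σ 0).1), c) := by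
  have h1 := lam.ax_counit X (M.qT q (Term.var σ))
  have h2 := congrArg Prod.fst (M.firstTrans_of_Tr lam h X q σ q' c j ht)
  exact Prod.ext h1 h2

theorem QM.law_drop (M : QM) (lam : DistLaw M.Op M.ar M.A) (h : M.ExtendsRho lam)
    (X : Type) (q : M.Q) (σ : Stream' (X × M.A)) (q' : M.Q) (c : M.A) (j : ℕ)
    (ht : M.Tr q (σ 0).2 (σ 1).2 q' c j) :
    (lam.law X (M.qT q (Term.var σ))).drop 1 = lam.law X (M.qT q' (Term.var (σ.drop j))) := by
  have h2 := congrArg Prod.snd (M.firstTrans_of_Tr lam h _ q (sTails σ) q' c j ht)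
  rw [lam.drop_law]
  exact congrArg (lam.law X) h2

/-- Both laws agree on depth-one terms `q(σ)`. -/
theorem QM.agree_one (M : QM) (lam lam' : DistLaw M.Op M.ar M.A)
    (h : M.ExtendsRho lam) (h' : M.ExtendsRho lam') (X : Type) (n : ℕ) :
    ∀ (q : M.Q) (σ : Stream' (X × M.A)),
      lam.law X (M.qT q (Term.var σ)) n = lam'.law X (M.qT q (Term.var σ)) n := by
  induction n with
  | zero =>
    intro q σ
    obtain ⟨q', c, j, ht⟩ := M.exists_Tr q (σ 0).2 (σ 1).2
    rw [M.law_zero lam h X q σ q' c j ht, M.law_zero lam' h' X q σ q' c j ht]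
  | succ n ih =>
    intro q σ
    obtain ⟨q', c, j, ht⟩ := M.exists_Tr q (σ 0).2 (σ 1).2
    have e1 := congrFun (M.law_drop lam h X q σ q' c j ht) n
    have e2 := congrFun (M.law_drop lam' h' X q σ q' c j ht) n
    have e3 := ih q' (σ.drop j)
    exact e1.trans (e3.trans e2.symm)

/-- Compositionality for one unary symbol. -/
theorem QM.law_qT (M : QM) (lam : DistLaw M.Op M.ar M.A) (X : Type) (q : M.Q)
    (t : Term M.Op M.ar (Stream' (X × M.A))) :
    lam.law X (M.qT q t) = Stream'.map (Prod.map Term.join id)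
      (lam.law (Term M.Op M.ar X) (M.qT q (Term.var (lam.law X t)))) :=
  lam.ax_mult X (M.qT q (Term.var t))

theorem QM.CT_map (M : QM) {X Y : Type} (f : X → Y) : (M.CT X).map f = M.CT Y := by
  unfold QM.CT
  simp only [Term.map]
  congr 1
  funext i
  exact i.elim0

theorem QM.C_zero (M : QM) (lam : DistLaw M.Op M.ar M.A) (h : M.ExtendsRho lam) (X : Type) :
    lam.law X (M.CT _) 0 = (M.CT X, M.dollar) := by
  have h1 := lam.ax_counit X (M.CT _)
  rw [M.CT_map] at h1
  exact Prod.ext h1 (congrArg Prod.fst (h.1 X))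

theorem QM.C_drop (M : QM) (lam : DistLaw M.Op M.ar M.A) (h : M.ExtendsRho lam) (X : Type) :
    (lam.law X (M.CT _)).drop 1 = Stream'.map (Prod.map Term.join id)
      (lam.law (Term M.Op M.ar X) (M.qT M.q1 (Term.var (lam.law X (M.CT _))))) := by
  rw [lam.drop_law, M.CT_map, ← M.law_qT]
  exact congrArg (lam.law X) (congrArg Prod.snd (h.1 _))

theorem QM.op_some (M : QM) {X : Type} (q : M.Q)
    (ts : Fin (M.ar (some q)) → Term M.Op M.ar X) :
    Term.op (some q) ts = M.qT q (ts (0 : Fin 1)) := by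
  unfold QM.qT
  congr 1
  funext i
  exact congrArg ts (Subsingleton.elim (α := Fin 1) i 0)

theorem QM.qT_ne (M : QM) {X : Type} (t : Term M.Op M.ar X) : ∀ q, M.qT q t ≠ t := by
  induction t with
  | var x => intro q hq; unfold QM.qT at hq; cases hq
  | op o ts ih =>
    intro q hq
    unfold QM.qT at hq
    injection hq with h1 h2
    subst h1
    have h3 := congrFun (eq_of_heq h2) (0 : Fin 1)
    exact ih (0 : Fin 1) q ((M.op_some q ts).symm.trans h3)

/-- One step of the residual stream along a machine transition. -/
theorem QM.resid (M : QM) (lam : DistLaw M.Op M.ar M.A) (h : M.ExtendsRho lam) (X : Type)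
    (s : Stream' (Term M.Op M.ar X × M.A)) (q : M.Q) (n k : ℕ)
    (hs : s.drop (n + 1) = Stream'.map (Prod.map Term.join id)
      (lam.law (Term M.Op M.ar X) (M.qT q (Term.var (s.drop k)))))
    (q' : M.Q) (c : M.A) (j : ℕ) (ht : M.Tr q (s k).2 (s (k + 1)).2 q' c j) :
    s (n + 1) = (M.qT q (s k).1, c) ∧
    s.drop (n + 2) = Stream'.map (Prod.map Term.join id)
      (lam.law (Term M.Op M.ar X) (M.qT q' (Term.var (s.drop (k + j))))) := by
  have hd : ∀ i m, s.drop m i = s (i + m) := fun _ _ => rfl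
  have ht' : M.Tr q ((s.drop k) 0).2 ((s.drop k) 1).2 q' c j := by
    rw [hd, hd, Nat.zero_add, Nat.add_comm 1 k]; exact ht
  have a1 := M.law_zero lam h _ q (s.drop k) q' c j ht'
  have a2 := M.law_drop lam h _ q (s.drop k) q' c j ht'
  constructor
  · have e := congrFun hs 0
    rw [hd, Nat.zero_add] at e
    rw [e]
    change Prod.map Term.join id (lam.law _ _ 0) = _
    rw [a1, hd, Nat.zero_add]
    rfl
  · rw [Stream'.drop_drop] at a2
    have e := congrArg (Stream'.drop 1) hs
    rw [Stream'.drop_drop] at e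
    rw [show n + 2 = n + 1 + 1 from rfl, e, ← Nat.add_comm j k, Nat.add_comm j k, ← a2]
    rfl

/-- Totality of the machine step on a non-stuck configuration, in terms of `Tr`. -/
theorem QM.step_Tr (M : QM) {q : M.Q} {w : List M.A} {cfg : M.Q × List M.A}
    (hst : M.Step (q, w) cfg) : ∃ q' c j, cfg = (q', w.drop j ++ [c]) ∧ j ≤ w.length ∧
      ∀ a b, (∀ x, 0 < j → w[0]? = some x → x = a) → (∀ x, 1 < j → w[1]? = some x → x = b) →
        M.Tr q a b q' c j := by
  cases hst with
  | @step0 _ _ q' c h0 =>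
    exact ⟨q', c, 0, rfl, Nat.zero_le _, fun a b _ _ => Or.inl ⟨h0, rfl⟩⟩
  | @step1 _ a w q' c h0 h1 =>
    refine ⟨q', c, 1, rfl, by simp, fun x y hx _ => Or.inr (Or.inl ⟨h0, ?_, rfl⟩)⟩
    rw [← hx a (by omega) (by simp)]; exact h1
  | @step2 _ a b w q' c h0 h1 h2 =>
    refine ⟨q', c, 2, rfl, by simp, fun x y hx hy => Or.inr (Or.inr ⟨h0, ?_, ?_, rfl⟩)⟩
    · rw [← hx a (by omega) (by simp)]; exact h1
    · rw [← hx a (by omega) (by simp), ← hy b (by omega) (by simp)]; exact h2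

/-- Both laws agree on the constant. -/
theorem QM.agree_C (M : QM) (hnt : ¬ M.Terminates) (lam lam' : DistLaw M.Op M.ar M.A)
    (h : M.ExtendsRho lam) (h' : M.ExtendsRho lam') (X : Type) :
    lam.law X (M.CT _) = lam'.law X (M.CT _) := by
  have z := M.C_zero lam h X
  have z' := M.C_zero lam' h' X
  have d := M.C_drop lam h X
  have d' := M.C_drop lam' h' X
  generalize lam.law X (M.CT _) = s at z d
  generalize lam'.law X (M.CT _) = s' at z' d'
  have key : ∀ n, (∀ i ≤ n, s i = s' i) ∧ ∃ q k w,
      Relation.ReflTransGen M.Step (M.q1, [M.dollar]) (q, w) ∧ k + w.length = n + 1 ∧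
      (∀ (i : ℕ) a, w[i]? = some a → a = (s (k + i)).2) ∧
      s.drop (n + 1) = Stream'.map (Prod.map Term.join id)
        (lam.law (Term M.Op M.ar X) (M.qT q (Term.var (s.drop k)))) ∧
      s'.drop (n + 1) = Stream'.map (Prod.map Term.join id)
        (lam'.law (Term M.Op M.ar X) (M.qT q (Term.var (s'.drop k)))) := by
    intro n
    induction n with
    | zero =>
      refine ⟨fun i hi => ?_, M.q1, 0, [M.dollar], .refl, rfl, fun i a hia => ?_, d, d'⟩
      · obtain rfl : i = 0 := by omega
        rw [z, z']
      · obtain ⟨hi, rfl⟩ := List.getElem?_eq_some_iff.1 hia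
        have hi' : i = 0 := by simpa using hi
        subst hi'
        simp [z]
    | succ n ih =>
      obtain ⟨hag, q, k, w, hr, hk, hw, e, e'⟩ := ih
      have hns : ¬ M.Stuck (q, w) := fun hs => hnt ⟨_, hr, hs⟩
      unfold QM.Stuck at hns
      push Not at hns
      obtain ⟨cfg, hst⟩ := hns
      obtain ⟨q', c, j, rfl, hj, ht⟩ := M.step_Tr hst
      have t1 := ht (s k).2 (s (k + 1)).2 (fun x _ hx => hw 0 x hx) (fun x _ hx => hw 1 x hx)
      have t2 := ht (s' k).2 (s' (k + 1)).2
        (fun x _ hx => by rw [← hag k (by omega)]; exact hw 0 x hx)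
        (fun x _ hx => by rw [← hag (k + 1) (by omega)]; exact hw 1 x hx)
      obtain ⟨r1, r2⟩ := M.resid lam h X s q n k e q' c j t1
      obtain ⟨r1', r2'⟩ := M.resid lam' h' X s' q n k e' q' c j t2
      have hkn : k ≤ n := by
        by_contra hc
        obtain rfl : k = n + 1 := by omega
        exact M.qT_ne _ q (congrArg Prod.fst r1).symm
      refine ⟨fun i hi => ?_, q', k + j, w.drop j ++ [c], hr.tail hst, ?_, ?_, r2, r2'⟩
      · rcases Nat.lt_or_ge n i with hlt | hle
        · obtain rfl : i = n + 1 := by omega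
          rw [r1, r1', hag k hkn]
        · exact hag i hle
      · simp; omega
      · intro i a hia
        rw [List.getElem?_append] at hia
        split_ifs at hia with hi
        · rw [List.getElem?_drop] at hia
          rw [Nat.add_assoc]
          exact hw _ _ hia
        · obtain ⟨hi2, hc⟩ := List.getElem?_eq_some_iff.1 hia
          simp at hi hi2 hc
          have : k + j + i = n + 1 := by omega
          rw [this, r1, ← hc]
  funext n
  exact (key n).1 n le_rfl

/-- If a queue machine `M` does not terminate from the initial configuration `(q1, $)`,
then at most one distributive law extends the induced stream biGSOS law `ρ_M`. -/
theorem atMostOne_distLaw_extends (M : QM) (hnt : ¬ M.Terminates)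
    (lam lam' : DistLaw M.Op M.ar M.A)
    (h : M.ExtendsRho lam) (h' : M.ExtendsRho lam') : lam = lam' := by
  have key : ∀ (X : Type) (u : Term M.Op M.ar (Stream' (X × M.A))),
      lam.law X u = lam'.law X u := by
    intro X u
    induction u with
    | var σ => rw [lam.ax_unit, lam'.ax_unit]
    | op o ts ih =>
      cases o with
      | none =>
        have e : Term.op none ts = M.CT (Stream' (X × M.A)) := by
          unfold QM.CT
          congr 1
          funext i
          exact i.elim0
        exact (congrArg (lam.law X) e).trans
          ((M.agree_C hnt lam lam' h h' X).trans (congrArg (lam'.law X) e).symm)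
      | some q =>
        have e : Term.op (some q) ts = M.qT q (ts (0 : Fin 1)) := by
          unfold QM.qT
          congr 1
          funext i
          exact congrArg ts (Subsingleton.elim (α := Fin 1) i 0)
        have ih0 := ih (0 : Fin 1)
        refine (congrArg (lam.law X) e).trans (Eq.trans ?_ (congrArg (lam'.law X) e).symm)
        generalize ts (0 : Fin 1) = t at ih0
        rw [M.law_qT lam X q t, M.law_qT lam' X q t, ih0]
        refine congrArg (Stream'.map (Prod.map Term.join id)) ?_
        funext n
        exact M.agree_one lam lam' h h' _ n q _
  have hl : lam.law = lam'.law := by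
    funext X u
    exact key X u
  cases lam
  cases lam'
  cases hl
  rfl
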